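/- arXiv:2602.10836 — 2 statements merged into one kernel-verified Lean document; each statement's English description precedes it below -/
import Mathlib

section
/- For any fixed t₀ ≥ 0, the time-averaged oscillatory term satisfies ω · [1/(t−t₀)] ∫_{t₀}ᵗ (b(x(s)) × v_ω(s))/(ω |B(x(s))|) ds → 0 in C⁰_loc((t₀,∞)) as ω → ∞, i.e., the convergence to 0 is uniform on every compact subset of (t₀,∞). -/
open MeasureTheory Filter RealInnerProductSpace

noncomputable section

abbrev E3 := EuclideanSpace ℝ (Fin 3)

/-- Cross product on `E3`. -/
def cross (u v : E3) : E3 :=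
  !₂[u 1 * v 2 - u 2 * v 1, u 2 * v 0 - u 0 * v 2, u 0 * v 1 - u 1 * v 0]

/-- Partial derivative of `f` in the `i`-th coordinate direction. -/
def pd (f : E3 → E3) (i : Fin 3) (x : E3) : E3 := fderiv ℝ f x (EuclideanSpace.single i 1)

/-- Curl of a vector field. -/
def curl (f : E3 → E3) (x : E3) : E3 :=
  !₂[pd f 1 x 2 - pd f 2 x 1, pd f 2 x 0 - pd f 0 x 2, pd f 0 x 1 - pd f 1 x 0]

/-- Divergence of a vector field. -/
def divergence (f : E3 → E3) (x : E3) : ℝ := ∑ i, pd f i x i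
/-- Convergence in $C^{0,\alpha}_{loc}$ as $\omega\to\infty$: for every compact
$K\subset\mathbb{R}$ the $\alpha$-Hölder norm of $f_\omega - g$ on $K$ tends to $0$
(both the sup part and the Hölder seminorm part become arbitrarily small). -/
def HolderLocConv {E : Type*} [NormedAddCommGroup E] (f : ℝ → ℝ → E) (g : ℝ → E)
    (α : ℝ) : Prop :=
  ∀ K : Set ℝ, IsCompact K → ∀ ε > 0, ∃ W : ℝ, ∀ ω ≥ W,
    (∀ t ∈ K, ‖f ω t - g t‖ ≤ ε) ∧
    ∀ s ∈ K, ∀ t ∈ K, ‖(f ω s - g s) - (f ω t - g t)‖ ≤ ε * |s - t| ^ α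
theorem cross_sub_left (u w v : E3) : cross (u - w) v = cross u v - cross w v := by
  ext i; fin_cases i <;> simp [cross] <;> ring

theorem cross_eq_neg_cross (u v : E3) : cross u v = -cross v u := by
  ext i; fin_cases i <;> simp [cross] <;> ring

theorem cross_smul_left (c : ℝ) (u v : E3) : cross (c • u) v = c • cross u v := by
  ext i; fin_cases i <;> simp [cross] <;> ring

theorem inner_self_cross (u v : E3) : ⟪u, cross u v⟫ = 0 := by
  simp [PiLp.inner_apply, Fin.sum_univ_three, cross]; ring

theorem norm_cross_le (u v : E3) : ‖cross u v‖ ≤ ‖u‖ * ‖v‖ := by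
  refine le_of_sq_le_sq ?_ (by positivity)
  rw [mul_pow]
  simp only [EuclideanSpace.norm_sq_eq, Fin.sum_univ_three, Real.norm_eq_abs, sq_abs]
  simp [cross]
  nlinarith [sq_nonneg (u 0 * v 0 + u 1 * v 1 + u 2 * v 2)]

theorem Continuous.cross {f g : ℝ → E3} (hf : Continuous f) (hg : Continuous g) :
    Continuous fun s => cross (f s) (g s) := by
  unfold _root_.cross
  refine (PiLp.continuous_toLp 2 _).comp (continuous_pi fun i => ?_)
  fin_cases i <;> simp <;> fun_prop

/-- The speed of a charged particle in a magnetic field is conserved. -/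
theorem norm_eq_of_hasDerivAt_cross {v β : ℝ → E3} {ω : ℝ}
    (hv : ∀ s, HasDerivAt v (ω • cross (v s) (β s)) s) (s t : ℝ) : ‖v s‖ = ‖v t‖ := by
  have hd : ∀ r, HasDerivAt (fun r => ‖v r‖ ^ 2) 0 r := fun r => by
    simpa [inner_smul_right, inner_self_cross] using (hv r).norm_sq
  have h := is_const_of_deriv_eq_zero (fun r => (hd r).differentiableAt)
    (fun r => (hd r).deriv) s t
  exact (sq_eq_sq₀ (norm_nonneg _) (norm_nonneg _)).1 h

/-- Integration by parts bounds the weighted integral of `cross β v` when `v` rotates rapidly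
around a field `γ` close to `β`. -/
theorem norm_integral_smul_cross_le {v β γ : ℝ → E3} {g g' : ℝ → ℝ} {ω V G G' δ a t : ℝ}
    (hω : 0 < ω) (hat : a ≤ t) (hβ : Continuous β) (hγ : Continuous γ) (hg' : Continuous g')
    (hv : ∀ s, HasDerivAt v (ω • cross (v s) (γ s)) s) (hg : ∀ s, HasDerivAt g (g' s) s)
    (hV : ∀ s, ‖v s‖ ≤ V) (hG : ∀ s ∈ Set.Icc a t, ‖g s‖ ≤ G)
    (hG' : ∀ s ∈ Set.Icc a t, ‖g' s‖ ≤ G') (hδ : ∀ s ∈ Set.Icc a t, ‖β s - γ s‖ ≤ δ) :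
    ‖∫ s in a..t, g s • cross (β s) (v s)‖ ≤
      (G * (δ * V) + ω⁻¹ * (G' * V)) * (t - a) + ω⁻¹ * (2 * (G * V)) := by
  have hvc : Continuous v := continuous_iff_continuousAt.2 fun s => (hv s).continuousAt
  have hgc : Continuous g := continuous_iff_continuousAt.2 fun s => (hg s).continuousAt
  have hV0 : 0 ≤ V := (norm_nonneg _).trans (hV a)
  have hG0 : 0 ≤ G := (norm_nonneg _).trans (hG a ⟨le_rfl, hat⟩)
  have hcγ := hvc.cross hγ
  have hgv : ∀ s, HasDerivAt (fun s => g s • v s)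
      (g s • ω • cross (v s) (γ s) + g' s • v s) s := fun s => (hg s).smul (hv s)
  have hdc : Continuous fun s => g s • ω • cross (v s) (γ s) + g' s • v s := by fun_prop
  have hparts := intervalIntegral.integral_eq_sub_of_hasDerivAt (fun s _ => hgv s)
    (hdc.intervalIntegrable a t)
  have hsplit : ∀ s, g s • cross (β s) (v s) =
      (g s • cross (β s - γ s) (v s) + ω⁻¹ • g' s • v s) -
        ω⁻¹ • (g s • ω • cross (v s) (γ s) + g' s • v s) := fun s => by
    rw [cross_sub_left, cross_eq_neg_cross (γ s), smul_add, smul_comm (g s) ω,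
      inv_smul_smul₀ hω.ne']
    module
  have hcd := (hβ.sub hγ).cross hvc
  have hdc' : Continuous fun s => ω⁻¹ • (g s • ω • cross (v s) (γ s) + g' s • v s) :=
    hdc.const_smul ω⁻¹
  have hrest : Continuous fun s => g s • cross (β s - γ s) (v s) + ω⁻¹ • g' s • v s :=
    (hgc.smul hcd).add (by fun_prop)
  simp_rw [hsplit]
  rw [intervalIntegral.integral_sub (hrest.intervalIntegrable a t)
    (hdc'.intervalIntegrable a t), intervalIntegral.integral_smul, hparts]
  refine (norm_sub_le _ _).trans (add_le_add ?_ ?_)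
  · have h := intervalIntegral.norm_integral_le_of_norm_le_const (a := a) (b := t)
      (f := fun s => g s • cross (β s - γ s) (v s) + ω⁻¹ • g' s • v s)
      (C := G * (δ * V) + ω⁻¹ * (G' * V)) ?_
    · rwa [abs_of_nonneg (sub_nonneg.2 hat)] at h
    · intro s hs
      rw [Set.uIoc_of_le hat] at hs
      have hs' := Set.Ioc_subset_Icc_self hs
      have hδ0 : 0 ≤ δ := (norm_nonneg _).trans (hδ s hs')
      refine (norm_add_le _ _).trans (add_le_add ?_ ?_)
      · rw [norm_smul]
        exact mul_le_mul (hG s hs') ((norm_cross_le _ _).trans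
          (mul_le_mul (hδ s hs') (hV s) (norm_nonneg _) hδ0)) (norm_nonneg _) hG0
      · rw [norm_smul, norm_smul, norm_inv, Real.norm_of_nonneg hω.le]
        gcongr
        · exact (norm_nonneg _).trans (hG' s hs')
        · exact hG' s hs'
        · exact hV s
  · rw [norm_smul, norm_inv, Real.norm_of_nonneg hω.le]
    have hb : ∀ s ∈ Set.Icc a t, ‖g s • v s‖ ≤ G * V := fun s hs => by
      rw [norm_smul]
      exact mul_le_mul (hG s hs) (hV s) (norm_nonneg _) hG0
    gcongr
    linarith [norm_sub_le (g t • v t) (g a • v a), hb t ⟨hat, le_rfl⟩, hb a ⟨le_rfl, hat⟩]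

/-- Composition with a continuous map preserves convergence that is uniform on a compact set. -/
theorem HolderLocConv.eventually_norm_comp_sub_le {f : ℝ → ℝ → E3} {x : ℝ → E3}
    (h : HolderLocConv f x 0) (hx : Continuous x) {B : E3 → E3} (hB : Continuous B)
    {K : Set ℝ} (hK : IsCompact K) {δ : ℝ} (hδ : 0 < δ) :
    ∀ᶠ ω in atTop, ∀ s ∈ K, ‖B (x s) - B (f ω s)‖ ≤ δ := by
  have hu := (hK.image hx).uniformContinuousAt_of_continuousAt B
    (fun _ _ => hB.continuousAt) (Metric.dist_mem_uniformity hδ)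
  obtain ⟨ε, hε, hεB⟩ := Metric.mem_uniformity_dist.1 hu
  obtain ⟨W, hW⟩ := h K hK (ε / 2) (half_pos hε)
  filter_upwards [eventually_ge_atTop W] with ω hω s hs
  have hd : dist (x s) (f ω s) < ε := by
    rw [dist_comm, dist_eq_norm]
    linarith [(hW ω hω).1 s hs]
  have := hεB hd (Set.mem_image_of_mem x hs)
  rw [← dist_eq_norm]
  exact le_of_lt this

theorem eventually_norm_integral_smul_cross_le {B : E3 → E3} (hB : Continuous B) {v₀ : E3}
    {xω : ℝ → ℝ → E3} (hxC : ∀ ω > (0:ℝ), ContDiff ℝ 2 (xω ω))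
    (hode : ∀ ω > (0:ℝ), ∀ t : ℝ,
      deriv (deriv (xω ω)) t = ω • cross (deriv (xω ω) t) (B (xω ω t)))
    (hinit : ∀ ω > (0:ℝ), deriv (xω ω) 0 = v₀) {x : ℝ → E3} (hx : Continuous x)
    (hconv : HolderLocConv xω x 0) {g : ℝ → ℝ} (hg : ContDiff ℝ 1 g) {a T ε : ℝ}
    (haT : a ≤ T) (hε : 0 < ε) :
    ∀ᶠ ω in atTop, ∀ t ∈ Set.Icc a T,
      ‖∫ s in a..t, g s • cross (B (x s)) (deriv (xω ω) s)‖ ≤ ε := by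
  have hg' : Continuous (deriv g) := hg.continuous_deriv le_rfl
  obtain ⟨G, hG⟩ := (isCompact_Icc (a := a) (b := T)).exists_bound_of_continuousOn
    hg.continuous.continuousOn
  obtain ⟨G', hG'⟩ := (isCompact_Icc (a := a) (b := T)).exists_bound_of_continuousOn
    hg'.continuousOn
  have hG0 : 0 ≤ G := (norm_nonneg _).trans (hG a ⟨le_rfl, haT⟩)
  have hG'0 : 0 ≤ G' := (norm_nonneg _).trans (hG' a ⟨le_rfl, haT⟩)
  have hTa : 0 ≤ T - a := sub_nonneg.2 haT
  obtain ⟨δ, hδ, hδε⟩ : ∃ δ > 0, G * (δ * ‖v₀‖) * (T - a) ≤ ε / 2 := by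
    have hA : 0 ≤ G * ‖v₀‖ * (T - a) := by positivity
    refine ⟨ε / 2 / (G * ‖v₀‖ * (T - a) + 1), by positivity, ?_⟩
    have h : ε / 2 / (G * ‖v₀‖ * (T - a) + 1) * (G * ‖v₀‖ * (T - a) + 1) = ε / 2 :=
      div_mul_cancel₀ _ (by positivity)
    have hpos : 0 < ε / 2 / (G * ‖v₀‖ * (T - a) + 1) := by positivity
    nlinarith
  have hlim : Tendsto (fun ω : ℝ => ω⁻¹ * (G' * ‖v₀‖ * (T - a) + 2 * (G * ‖v₀‖))) atTop
      (nhds 0) := by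
    simpa using tendsto_inv_atTop_zero.mul_const (G' * ‖v₀‖ * (T - a) + 2 * (G * ‖v₀‖))
  filter_upwards [eventually_gt_atTop 0, hlim.eventually_lt_const (half_pos hε),
    hconv.eventually_norm_comp_sub_le hx hB (isCompact_Icc (a := a) (b := T)) hδ]
    with ω hω hsmall hclose t ht
  have hv : ∀ s, HasDerivAt (deriv (xω ω)) (ω • cross (deriv (xω ω) s) (B (xω ω s))) s :=
    fun s => by
      rw [← hode ω hω s]
      exact ((contDiff_succ_iff_deriv (n := 1).1 (hxC ω hω)).2.2.differentiable
        one_ne_zero s).hasDerivAt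
  have hsub : Set.Icc a t ⊆ Set.Icc a T := Set.Icc_subset_Icc_right ht.2
  have hbound := norm_integral_smul_cross_le hω ht.1 (hB.comp hx)
    (hB.comp (hxC ω hω).continuous) hg' hv
    (fun s => (hg.differentiable one_ne_zero s).hasDerivAt)
    (fun s => ((norm_eq_of_hasDerivAt_cross hv s 0).trans (by rw [hinit ω hω])).le)
    (fun s hs => hG s (hsub hs)) (fun s hs => hG' s (hsub hs))
    (fun s hs => hclose s (hsub hs))
  have hmono : (G * (δ * ‖v₀‖) + ω⁻¹ * (G' * ‖v₀‖)) * (t - a) ≤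
      (G * (δ * ‖v₀‖) + ω⁻¹ * (G' * ‖v₀‖)) * (T - a) :=
    mul_le_mul_of_nonneg_left (by linarith [ht.2]) (by positivity)
  refine hbound.trans ?_
  linarith

/-- The time average of the oscillatory term is $o(1/\omega)$ in
$C^0_{loc}((t_0,\infty))$. -/
theorem stmt9 (B : E3 → E3) (hB : ContDiff ℝ 2 B) (hne : ∀ y : E3, B y ≠ 0)
    (hdiv : ∀ y : E3, divergence B y = 0) (x₀ v₀ : E3)
    (b : E3 → E3) (hb : b = fun y => ‖B y‖⁻¹ • B y)
    (xω : ℝ → ℝ → E3)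
    (hxC : ∀ ω > (0:ℝ), ContDiff ℝ 2 (xω ω))
    (hode : ∀ ω > (0:ℝ), ∀ t : ℝ,
      deriv (deriv (xω ω)) t = ω • cross (deriv (xω ω) t) (B (xω ω t)))
    (hinit : ∀ ω > (0:ℝ), xω ω 0 = x₀ ∧ deriv (xω ω) 0 = v₀)
    (x : ℝ → E3) (hx3 : ContDiff ℝ 3 x)
    (hconv : ∀ α : ℝ, 0 ≤ α → α < 1 → HolderLocConv xω x α)
    (t₀ : ℝ) (ht₀ : 0 ≤ t₀) :
    TendstoLocallyUniformlyOn
      (fun ω t => ω • ((t - t₀)⁻¹ •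
        ∫ s in t₀..t, (ω * ‖B (x s)‖)⁻¹ • cross (b (x s)) (deriv (xω ω) s)))
      (fun _ => (0:E3)) atTop (Set.Ioi t₀) := by
  have hx : Continuous x := hx3.continuous
  have hg : ContDiff ℝ 1 fun s => (‖B (x s)‖ ^ 2)⁻¹ :=
    (((hB.of_le one_le_two).comp (hx3.of_le (by norm_num))).norm_sq ℝ).inv
      fun s => pow_ne_zero 2 (norm_ne_zero_iff.2 (hne _))
  rw [Metric.tendstoLocallyUniformlyOn_iff]
  intro η hη t₁ ht₁
  have ht₁' : 0 < t₁ - t₀ := sub_pos.2 ht₁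
  refine ⟨Set.Ioo (t₀ + (t₁ - t₀) / 2) (t₁ + 1), mem_nhdsWithin_of_mem_nhds
    (Ioo_mem_nhds (by linarith) (by linarith)), ?_⟩
  filter_upwards [eventually_gt_atTop 0, eventually_norm_integral_smul_cross_le hB.continuous
    hxC hode (fun ω hω => (hinit ω hω).2) hx (hconv 0 le_rfl one_pos) hg
    (a := t₀) (T := t₁ + 1) (by linarith) (show 0 < η * ((t₁ - t₀) / 2) / 2 by positivity)]
    with ω hω hint t ht
  have ht' : (t₁ - t₀) / 2 < t - t₀ := by linarith [ht.1]
  have htpos : 0 < t - t₀ := by linarith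
  have hcancel : ω • ∫ s in t₀..t, (ω * ‖B (x s)‖)⁻¹ • cross (b (x s)) (deriv (xω ω) s) =
      ∫ s in t₀..t, (‖B (x s)‖ ^ 2)⁻¹ • cross (B (x s)) (deriv (xω ω) s) := by
    rw [← intervalIntegral.integral_smul]
    refine intervalIntegral.integral_congr fun s _ => ?_
    have hBs := norm_ne_zero_iff.2 (hne (x s))
    simp only [hb, cross_smul_left, smul_smul]
    congr 1
    field_simp
  rw [dist_zero_left, smul_comm, hcancel, norm_smul, norm_inv, Real.norm_of_nonneg htpos.le,
    inv_mul_lt_iff₀ htpos]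
  have hle := hint t ⟨by linarith, ht.2.le⟩
  have hlt : η * ((t₁ - t₀) / 2) / 2 < (t - t₀) * η := by nlinarith
  exact hle.trans_lt hlt
end
end

section
/- With x, h and μ₀ as in the zero order guiding-centre limit, the parallel speed satisfies the mirror-force equation ḣ(t) = −μ₀ · b(x(t)) · ∇|B|(x(t)) for all t ∈ ℝ. -/
open MeasureTheory Filter RealInnerProductSpace

noncomputable section

lemma inner_eq_coords (u v : E3) : ⟪u, v⟫ = u 0 * v 0 + u 1 * v 1 + u 2 * v 2 := by
  simp [PiLp.inner_apply, Fin.sum_univ_three, mul_comm]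

lemma inner_cross_self_left (v w : E3) : ⟪v, cross v w⟫ = 0 := by
  simp only [inner_eq_coords, cross, Matrix.cons_val]
  ring

lemma inner_cross_self_right (v w : E3) : ⟪cross v w, w⟫ = 0 := by
  simp only [inner_eq_coords, cross, Matrix.cons_val]
  ring

lemma cross_add_smul_left (v w n : E3) (s : ℝ) :
    cross (v + s • w) n = cross v n + s • cross w n := by
  ext i
  fin_cases i <;> simp [cross] <;> ring

lemma cross_smul_right (v n : E3) (s : ℝ) : cross v (s • n) = s • cross v n := by
  ext i
  fin_cases i <;> simp [cross] <;> ring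

lemma cross_cross_unit (v n : E3) (hn : ‖n‖ = 1) :
    cross (cross v n) n = ⟪v, n⟫ • n - v := by
  have h1 : n 0 * n 0 + n 1 * n 1 + n 2 * n 2 = 1 := by
    rw [← inner_eq_coords, real_inner_self_eq_norm_sq, hn, one_pow]
  ext i
  fin_cases i <;> simp [cross, inner_eq_coords]
  · linear_combination (-v 0) * h1
  · linear_combination (-v 1) * h1
  · linear_combination (-v 2) * h1

lemma contDiff_cross {F : Type*} [NormedAddCommGroup F] [NormedSpace ℝ F] {n : WithTop ℕ∞}
    {f g : F → E3} (hf : ContDiff ℝ n f) (hg : ContDiff ℝ n g) :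
    ContDiff ℝ n fun y => cross (f y) (g y) := by
  rw [contDiff_euclidean] at *
  intro i
  fin_cases i <;> simp only [cross, PiLp.toLp_apply] <;> simp
  · exact ((hf 1).mul (hg 2)).sub ((hf 2).mul (hg 1))
  · exact ((hf 2).mul (hg 0)).sub ((hf 0).mul (hg 2))
  · exact ((hf 0).mul (hg 1)).sub ((hf 1).mul (hg 0))

lemma clm_apply_coord (A : E3 →L[ℝ] E3) (v : E3) (i : Fin 3) :
    A v i = v 0 * A (EuclideanSpace.single 0 1) i + v 1 * A (EuclideanSpace.single 1 1) i
      + v 2 * A (EuclideanSpace.single 2 1) i := by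
  have hv : v = v 0 • EuclideanSpace.single (0 : Fin 3) (1 : ℝ)
      + v 1 • EuclideanSpace.single (1 : Fin 3) (1 : ℝ)
      + v 2 • EuclideanSpace.single (2 : Fin 3) (1 : ℝ) := by
    ext j
    fin_cases j <;> simp
  conv_lhs => rw [hv]
  simp

/-- Gyro-average of the quadratic form of `A` on the plane orthogonal to a unit vector `n`. -/
lemma inner_cross_add_inner_self (A : E3 →L[ℝ] E3) (n v : E3) (hn : ‖n‖ = 1)
    (hA : ∀ w, ⟪n, A w⟫ = 0) :
    ⟪cross v n, A (cross v n)⟫ + ⟪v, A v⟫ - ⟪v, n⟫ * ⟪v, A n⟫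
      = (‖v‖ ^ 2 - ⟪v, n⟫ ^ 2) * ∑ i, A (EuclideanSpace.single i 1) i := by
  have h1 : n 0 * n 0 + n 1 * n 1 + n 2 * n 2 = 1 := by
    rw [← inner_eq_coords, real_inner_self_eq_norm_sq, hn, one_pow]
  set w : E3 := v - ⟪v, n⟫ • n with hw
  have hcross : cross v n = cross w n := by
    ext i
    fin_cases i <;> simp [cross, hw] <;> ring
  have hwn : ⟪w, n⟫ = 0 := by
    rw [hw, inner_sub_left, real_inner_smul_left, real_inner_self_eq_norm_sq, hn]
    ring
  have hww : ‖v‖ ^ 2 - ⟪v, n⟫ ^ 2 = ⟪w, w⟫ := by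
    rw [hw, inner_sub_left, inner_sub_right, inner_sub_right, real_inner_smul_left,
      real_inner_smul_left, real_inner_smul_right, real_inner_smul_right,
      real_inner_self_eq_norm_sq, real_inner_self_eq_norm_sq, hn, real_inner_comm n v]
    ring
  have hwA : ⟪v, A v⟫ - ⟪v, n⟫ * ⟪v, A n⟫ = ⟪w, A w⟫ := by
    rw [hw, inner_sub_left, real_inner_smul_left, hA, map_sub, map_smul, inner_sub_right,
      real_inner_smul_right]
    ring
  have key : ⟪cross w n, A (cross w n)⟫ + ⟪w, A w⟫ = ⟪w, w⟫ *
      (∑ i, A (EuclideanSpace.single i 1) i - ⟪n, A n⟫) := by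
    rw [inner_eq_coords] at hwn
    simp only [inner_eq_coords, clm_apply_coord A w, clm_apply_coord A n,
      clm_apply_coord A (cross w n), Fin.sum_univ_three]
    simp only [cross, PiLp.toLp_apply, Matrix.cons_val]
    generalize A (EuclideanSpace.single 0 1) 0 = a00
    generalize A (EuclideanSpace.single 0 1) 1 = a10
    generalize A (EuclideanSpace.single 0 1) 2 = a20
    generalize A (EuclideanSpace.single 1 1) 0 = a01
    generalize A (EuclideanSpace.single 1 1) 1 = a11
    generalize A (EuclideanSpace.single 1 1) 2 = a21
    generalize A (EuclideanSpace.single 2 1) 0 = a02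
    generalize A (EuclideanSpace.single 2 1) 1 = a12
    generalize A (EuclideanSpace.single 2 1) 2 = a22
    linear_combination
      ((w 0 * w 0 + w 1 * w 1 + w 2 * w 2) * (a00 + a11 + a22)
        - (w 0 * (w 0 * a00 + w 1 * a01 + w 2 * a02) + w 1 * (w 0 * a10 + w 1 * a11 + w 2 * a12)
          + w 2 * (w 0 * a20 + w 1 * a21 + w 2 * a22))) * h1
      + (w 0 * (n 0 * a00 + n 1 * a01 + n 2 * a02) + w 1 * (n 0 * a10 + n 1 * a11 + n 2 * a12)
          + w 2 * (n 0 * a20 + n 1 * a21 + n 2 * a22)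
        + (n 0 * (w 0 * a00 + w 1 * a01 + w 2 * a02) + n 1 * (w 0 * a10 + w 1 * a11 + w 2 * a12)
          + n 2 * (w 0 * a20 + w 1 * a21 + w 2 * a22))
        - (w 0 * n 0 + w 1 * n 1 + w 2 * n 2) * (a00 + a11 + a22)) * hwn
  rw [hcross, hww, add_sub_assoc, hwA, key, hA, sub_zero]

/-- The gyro-phase corrector: its derivative along the fast rotation cancels the oscillating part
of the parallel acceleration. -/
def gyroCorrector (B b : E3 → E3) (p : E3 × E3) : ℝ :=
  2⁻¹ * ⟪p.2, (‖B p.1‖⁻¹ • fderiv ℝ b p.1) (cross p.2 (b p.1))⟫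
    + ⟪p.2, b p.1⟫ * ⟪cross p.2 (b p.1), (‖B p.1‖⁻¹ • fderiv ℝ b p.1) (b p.1)⟫

lemma contDiff_gyroCorrector {B b : E3 → E3} (hB : ContDiff ℝ 2 B) (hne : ∀ y, B y ≠ 0)
    (hb : ContDiff ℝ 2 b) : ContDiff ℝ 1 (gyroCorrector B b) := by
  have hA : ContDiff ℝ 1 fun p : E3 × E3 => ‖B p.1‖⁻¹ • fderiv ℝ b p.1 :=
    (((hB.of_le one_le_two).comp contDiff_fst).norm ℝ fun p => hne p.1).inv
      (fun p => norm_ne_zero_iff.2 (hne p.1)) |>.smul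
      ((hb.fderiv_right (m := 1) (by norm_num)).comp contDiff_fst)
  have hbp : ContDiff ℝ 1 fun p : E3 × E3 => b p.1 := (hb.of_le one_le_two).comp contDiff_fst
  have hc := contDiff_cross contDiff_snd hbp
  exact (contDiff_const.mul (contDiff_snd.inner ℝ (hA.clm_apply hc))).add
    ((contDiff_snd.inner ℝ hbp).mul (hc.inner ℝ (hA.clm_apply hbp)))

lemma contDiff_unitField {B b : E3 → E3} (hB : ContDiff ℝ 2 B) (hne : ∀ y, B y ≠ 0)
    (hb : b = fun y => ‖B y‖⁻¹ • B y) : ContDiff ℝ 2 b := by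
  rw [hb]
  exact ((hB.norm ℝ hne).inv fun y => norm_ne_zero_iff.2 (hne y)).smul hB

lemma inner_fderiv_eq_zero_of_norm_eq_one {b : E3 → E3} (hb : Differentiable ℝ b)
    (h1 : ∀ y, ‖b y‖ = 1) (y w : E3) : ⟪b y, fderiv ℝ b y w⟫ = 0 := by
  have h := (hb y).hasFDerivAt.inner ℝ (hb y).hasFDerivAt
  have hc : (fun z => ⟪b z, b z⟫) = fun _ => (1 : ℝ) := by
    funext z
    rw [real_inner_self_eq_norm_sq, h1, one_pow]
  rw [hc] at h
  have h0 := congrArg (fun L => L w) (h.unique (hasFDerivAt_const (1 : ℝ) y))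
  simp [fderivInnerCLM_apply, real_inner_comm] at h0
  exact h0

lemma fderiv_gyroCorrector_snd {B b : E3 → E3} (hB : ContDiff ℝ 2 B) (hne : ∀ y, B y ≠ 0)
    (hb : b = fun y => ‖B y‖⁻¹ • B y) (y v : E3) :
    fderiv ℝ (gyroCorrector B b) (y, v) (0, cross v (B y))
      = 2⁻¹ * ((‖v‖ ^ 2 - ⟪v, b y⟫ ^ 2) * divergence b y) - ⟪v, fderiv ℝ b y v⟫ := by
  have hbC := contDiff_unitField hB hne hb
  have hn0 : ‖B y‖ ≠ 0 := norm_ne_zero_iff.2 (hne y)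
  have h1 : ∀ z, ‖b z‖ = 1 := fun z => by
    rw [hb, norm_smul, norm_inv, norm_norm, inv_mul_cancel₀ (norm_ne_zero_iff.2 (hne z))]
  have hBb : B y = ‖B y‖ • b y := by
    rw [hb, smul_smul, mul_inv_cancel₀ hn0, one_smul]
  have horth := inner_fderiv_eq_zero_of_norm_eq_one (hbC.differentiable two_ne_zero) h1 y
  set n := b y with hn
  set A := fderiv ℝ b y with hA
  set q := cross v n with hq
  have hrot : cross v (B y) = ‖B y‖ • q := by rw [hBb, cross_smul_right, ← hBb]
  have hlin : fderiv ℝ (gyroCorrector B b) (y, v) (0, cross v (B y))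
      = ‖B y‖ * fderiv ℝ (gyroCorrector B b) (y, v) (0, q) := by
    have : ((0 : E3), cross v (B y)) = ‖B y‖ • ((0 : E3), q) := by simp [hrot]
    rw [this, map_smul, smul_eq_mul]
  have hqq : cross q n = ⟪v, n⟫ • n - v := cross_cross_unit v n (h1 y)
  have hqn : ⟪q, n⟫ = 0 := inner_cross_self_right v n
  have hline : HasDerivAt (fun s : ℝ => ((y, v + s • q) : E3 × E3)) (0, q) 0 := by
    simpa using (hasDerivAt_const (0 : ℝ) y).prodMk
      (((hasDerivAt_id (0 : ℝ)).smul_const q).const_add v)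
  have hd1 : HasDerivAt (fun s : ℝ => gyroCorrector B b (y, v + s • q))
      (fderiv ℝ (gyroCorrector B b) (y, v) (0, q)) 0 := by
    have hF : HasFDerivAt (gyroCorrector B b) (fderiv ℝ (gyroCorrector B b) (y, v))
        ((fun s : ℝ => ((y, v + s • q) : E3 × E3)) 0) := by
      simpa using ((contDiff_gyroCorrector hB hne hbC).differentiable one_ne_zero
        (y, v)).hasFDerivAt
    exact hF.comp_hasDerivAt (0 : ℝ) hline
  have hd2 : HasDerivAt (fun s : ℝ => gyroCorrector B b (y, v + s • q))
      (‖B y‖⁻¹ * (2⁻¹ * (⟪q, A q⟫ + ⟪v, A (cross q n)⟫) + ⟪v, n⟫ * ⟪cross q n, A n⟫)) 0 := by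
    have heq : (fun s : ℝ => gyroCorrector B b (y, v + s • q)) = fun s : ℝ =>
        ‖B y‖⁻¹ * (2⁻¹ * (⟪v, A q⟫ + s * (⟪q, A q⟫ + ⟪v, A (cross q n)⟫)
          + s ^ 2 * ⟪q, A (cross q n)⟫)
          + ⟪v, n⟫ * (⟪q, A n⟫ + s * ⟪cross q n, A n⟫)) := by
      funext s
      simp only [gyroCorrector, ← hn, ← hA, cross_add_smul_left, ← hq, smul_apply,
        map_add, map_smul, inner_add_left, inner_add_right, real_inner_smul_left,
        real_inner_smul_right, hqn]
      ring
    rw [heq]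
    have hs := hasDerivAt_id (0 : ℝ)
    have := ((((hs.mul_const (⟪q, A q⟫ + ⟪v, A (cross q n)⟫)).const_add ⟪v, A q⟫).add
      ((hs.pow 2).mul_const ⟪q, A (cross q n)⟫)).const_mul (2⁻¹ : ℝ)).add
      (((hs.mul_const ⟪cross q n, A n⟫).const_add ⟪q, A n⟫).const_mul ⟪v, n⟫)
      |>.const_mul ‖B y‖⁻¹
    refine this.congr_deriv ?_
    simp
  have key := inner_cross_add_inner_self A n v (h1 y) horth
  have hdivb : divergence b y = ∑ i, A (EuclideanSpace.single i 1) i := rfl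
  rw [hlin, hd1.unique hd2, ← mul_assoc, mul_inv_cancel₀ hn0, one_mul, hdivb, ← key, hqq]
  simp only [map_sub, map_smul, inner_sub_left, inner_sub_right, real_inner_smul_left,
    real_inner_smul_right, horth, ← hq]
  ring

/-- For a divergence-free field, the divergence of its direction is `-b · ∇|B| / |B|`. -/
lemma divergence_unitField {B b : E3 → E3} (hB : Differentiable ℝ B) (hne : ∀ y, B y ≠ 0)
    (hdiv : ∀ y, divergence B y = 0) (hb : b = fun y => ‖B y‖⁻¹ • B y)
    (hbd : Differentiable ℝ b) (y : E3) :
    divergence b y = -(fderiv ℝ (fun z => ‖B z‖) y (b y) / ‖B y‖) := by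
  have hn0 : ‖B y‖ ≠ 0 := norm_ne_zero_iff.2 (hne y)
  have hBb : B = fun z => ‖B z‖ • b z := by
    funext z
    rw [hb, smul_smul, mul_inv_cancel₀ (norm_ne_zero_iff.2 (hne z)), one_smul]
  have hN : DifferentiableAt ℝ (fun z => ‖B z‖) y := (hB y).norm ℝ (hne y)
  have hfd : fderiv ℝ B y = ‖B y‖ • fderiv ℝ b y
      + (fderiv ℝ (fun z => ‖B z‖) y).smulRight (b y) := by
    conv_lhs => rw [hBb]
    exact (hN.hasFDerivAt.smul (hbd y).hasFDerivAt).fderiv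
  have hsum : fderiv ℝ (fun z => ‖B z‖) y (b y)
      = ∑ i, b y i * fderiv ℝ (fun z => ‖B z‖) y (EuclideanSpace.single i 1) := by
    have hv : b y = ∑ i, b y i • EuclideanSpace.single i (1 : ℝ) := by
      ext j
      fin_cases j <;> simp [Fin.sum_univ_three]
    conv_lhs => rw [hv]
    simp [map_sum]
  have h0 := hdiv y
  simp only [divergence, pd, hfd] at h0
  simp [Finset.sum_add_distrib, ← Finset.mul_sum] at h0
  rw [eq_neg_iff_add_eq_zero, ← mul_left_inj' hn0, add_mul, div_mul_cancel₀ _ hn0, hsum, zero_mul]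
  simp only [divergence, pd]
  rw [← h0, mul_comm]
  congr 1
  exact Finset.sum_congr rfl fun i _ => mul_comm _ _

lemma norm_deriv_eq_of_lorentz {B : E3 → E3} {y : ℝ → E3} {ω : ℝ} (hy : ContDiff ℝ 2 y)
    (hode : ∀ t, deriv (deriv y) t = ω • cross (deriv y t) (B (y t))) (t : ℝ) :
    ‖deriv y t‖ = ‖deriv y 0‖ := by
  have hv : ∀ s, HasDerivAt (deriv y) (deriv (deriv y) s) s := fun s =>
    (hy.differentiable_deriv_two s).hasDerivAt
  have hd : ∀ s, HasDerivAt (fun s => ⟪deriv y s, deriv y s⟫) 0 s := fun s => by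
    refine ((hv s).inner ℝ (hv s)).congr_deriv ?_
    rw [hode, real_inner_smul_right, real_inner_smul_left, inner_cross_self_left,
      real_inner_comm, inner_cross_self_left]
    ring
  have h := is_const_of_deriv_eq_zero (fun s => (hd s).differentiableAt)
    (fun s => (hd s).deriv) t 0
  simp only [real_inner_self_eq_norm_sq] at h
  exact (sq_eq_sq₀ (norm_nonneg _) (norm_nonneg _)).1 h

lemma norm_sub_le_of_lorentz {B : E3 → E3} {y : ℝ → E3} {ω : ℝ} (hy : ContDiff ℝ 2 y)
    (hode : ∀ t, deriv (deriv y) t = ω • cross (deriv y t) (B (y t))) (t : ℝ) :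
    ‖y t - y 0‖ ≤ ‖deriv y 0‖ * |t| := by
  have h := (convex_univ (𝕜 := ℝ) (E := ℝ)).norm_image_sub_le_of_norm_deriv_le (f := y)
    (C := ‖deriv y 0‖) (fun s _ => hy.differentiable two_ne_zero s)
    (fun s _ => (norm_deriv_eq_of_lorentz hy hode s).le) (Set.mem_univ 0) (Set.mem_univ t)
  simpa using h

lemma hasDerivAt_parallelSpeed {B b : E3 → E3} {y : ℝ → E3} {ω : ℝ} (hy : ContDiff ℝ 2 y)
    (hb : b = fun y => ‖B y‖⁻¹ • B y) (hbd : Differentiable ℝ b)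
    (hode : ∀ t, deriv (deriv y) t = ω • cross (deriv y t) (B (y t))) (t : ℝ) :
    HasDerivAt (fun s => ⟪deriv y s, b (y s)⟫)
      ⟪deriv y t, fderiv ℝ b (y t) (deriv y t)⟫ t := by
  have hv := (hy.differentiable_deriv_two t).hasDerivAt
  have hy1 := (hy.differentiable two_ne_zero t).hasDerivAt
  have hby : HasDerivAt (fun s => b (y s)) (fderiv ℝ b (y t) (deriv y t)) t :=
    (hbd (y t)).hasFDerivAt.comp_hasDerivAt t hy1
  refine (hv.inner ℝ hby).congr_deriv ?_
  have : ⟪deriv (deriv y) t, b (y t)⟫ = 0 := by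
    rw [hode, hb, real_inner_smul_left, real_inner_smul_right, inner_cross_self_right]
    ring
  rw [this, add_zero]

lemma hasDerivAt_gyroCorrector {B b : E3 → E3} {y : ℝ → E3} {ω : ℝ} (hB : ContDiff ℝ 2 B)
    (hne : ∀ y, B y ≠ 0) (hb : b = fun y => ‖B y‖⁻¹ • B y) (hy : ContDiff ℝ 2 y)
    (hode : ∀ t, deriv (deriv y) t = ω • cross (deriv y t) (B (y t))) (t : ℝ) :
    HasDerivAt (fun s => gyroCorrector B b (y s, deriv y s))
      (fderiv ℝ (gyroCorrector B b) (y t, deriv y t) (deriv y t, 0)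
        + ω * (2⁻¹ * ((‖deriv y t‖ ^ 2 - ⟪deriv y t, b (y t)⟫ ^ 2) * divergence b (y t))
          - ⟪deriv y t, fderiv ℝ b (y t) (deriv y t)⟫)) t := by
  have hv := (hy.differentiable_deriv_two t).hasDerivAt
  have hy1 := (hy.differentiable two_ne_zero t).hasDerivAt
  have hF := ((contDiff_gyroCorrector hB hne (contDiff_unitField hB hne hb)).differentiable
    one_ne_zero (y t, deriv y t)).hasFDerivAt
  refine (hF.comp_hasDerivAt t (hy1.prodMk hv)).congr_deriv ?_
  have hsplit : (deriv y t, deriv (deriv y) t)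
      = (deriv y t, 0) + ω • ((0 : E3), cross (deriv y t) (B (y t))) := by
    simp [hode]
  rw [hsplit, map_add, map_smul, smul_eq_mul, fderiv_gyroCorrector_snd hB hne hb]

lemma continuous_divergence {b : E3 → E3} (hb : ContDiff ℝ 2 b) :
    Continuous (divergence b) := by
  unfold divergence pd
  refine continuous_finsetSum _ fun i _ => ?_
  exact (PiLp.continuous_apply 2 _ i).comp
    ((hb.continuous_fderiv two_ne_zero).clm_apply continuous_const)

lemma continuous_fderiv_gyroCorrector {B b : E3 → E3} (hB : ContDiff ℝ 2 B)
    (hne : ∀ y, B y ≠ 0) (hb : ContDiff ℝ 2 b) :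
    Continuous fun p : E3 × E3 => fderiv ℝ (gyroCorrector B b) p (p.2, 0) :=
  ((contDiff_gyroCorrector hB hne hb).continuous_fderiv one_ne_zero).clm_apply
    (continuous_snd.prodMk continuous_const)

/-- Averaged equation for the parallel speed, with an explicit `O(1/ω)` remainder. -/
lemma parallelSpeed_sub_eq {B b : E3 → E3} {y : ℝ → E3} {ω : ℝ} (hB : ContDiff ℝ 2 B)
    (hne : ∀ y, B y ≠ 0) (hb : b = fun y => ‖B y‖⁻¹ • B y) (hω : ω ≠ 0) (hy : ContDiff ℝ 2 y)
    (hode : ∀ t, deriv (deriv y) t = ω • cross (deriv y t) (B (y t))) (t : ℝ) :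
    ⟪deriv y t, b (y t)⟫ - ⟪deriv y 0, b (y 0)⟫
      = (∫ s in (0 : ℝ)..t,
          2⁻¹ * ((‖deriv y 0‖ ^ 2 - ⟪deriv y s, b (y s)⟫ ^ 2) * divergence b (y s)))
        + ω⁻¹ * ((∫ s in (0 : ℝ)..t,
            fderiv ℝ (gyroCorrector B b) (y s, deriv y s) (deriv y s, 0))
          - (gyroCorrector B b (y t, deriv y t) - gyroCorrector B b (y 0, deriv y 0))) := by
  have hbC := contDiff_unitField hB hne hb
  have hyc := hy.continuous
  have hvc : Continuous (deriv y) := hy.continuous_deriv one_le_two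
  have hc1 : Continuous fun s =>
      2⁻¹ * ((‖deriv y 0‖ ^ 2 - ⟪deriv y s, b (y s)⟫ ^ 2) * divergence b (y s)) :=
    continuous_const.mul ((continuous_const.sub
      ((hvc.inner (hbC.continuous.comp hyc)).pow 2)).mul
      ((continuous_divergence hbC).comp hyc))
  have hc2 : Continuous fun s =>
      fderiv ℝ (gyroCorrector B b) (y s, deriv y s) (deriv y s, 0) :=
    (continuous_fderiv_gyroCorrector hB hne hbC).comp (hyc.prodMk hvc)
  have hZ : ∀ s, HasDerivAt
      (fun s => ⟪deriv y s, b (y s)⟫ + ω⁻¹ * gyroCorrector B b (y s, deriv y s))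
      (2⁻¹ * ((‖deriv y 0‖ ^ 2 - ⟪deriv y s, b (y s)⟫ ^ 2) * divergence b (y s))
        + ω⁻¹ * fderiv ℝ (gyroCorrector B b) (y s, deriv y s) (deriv y s, 0)) s := fun s => by
    refine ((hasDerivAt_parallelSpeed hy hb (hbC.differentiable two_ne_zero) hode s).add
      ((hasDerivAt_gyroCorrector hB hne hb hy hode s).const_mul ω⁻¹)).congr_deriv ?_
    rw [mul_add, ← mul_assoc ω⁻¹ ω, inv_mul_cancel₀ hω, norm_deriv_eq_of_lorentz hy hode s]
    ring
  have hFTC := intervalIntegral.integral_eq_sub_of_hasDerivAt (a := 0) (b := t)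
    (fun s _ => hZ s) ((hc1.add (continuous_const.mul hc2)).intervalIntegrable 0 t)
  rw [intervalIntegral.integral_add (hc1.intervalIntegrable 0 t)
    ((hc2.intervalIntegrable 0 t).const_mul ω⁻¹),
    intervalIntegral.integral_const_mul ω⁻¹] at hFTC
  linarith

lemma tendsto_intervalIntegral_of_bounded {f : ℝ → ℝ → ℝ} {g : ℝ → ℝ} {a c C : ℝ}
    (hf : ∀ ω > (0 : ℝ), Continuous (f ω))
    (hC : ∀ ω > (0 : ℝ), ∀ s ∈ Set.uIcc a c, |f ω s| ≤ C)
    (hlim : ∀ s, Tendsto (fun ω => f ω s) atTop (nhds (g s))) :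
    Tendsto (fun ω => ∫ s in a..c, f ω s) atTop (nhds (∫ s in a..c, g s)) := by
  refine intervalIntegral.tendsto_integral_filter_of_dominated_convergence (fun _ => C)
    ?_ ?_ intervalIntegrable_const (ae_of_all _ fun s _ => hlim s)
  · filter_upwards [eventually_gt_atTop 0] with ω hω
    exact (hf ω hω).aestronglyMeasurable
  · filter_upwards [eventually_gt_atTop 0] with ω hω
    exact ae_of_all _ fun s hs => hC ω hω s (Set.uIoc_subset_uIcc hs)

/-- Equi-Lipschitz functions whose integrals over short intervals tend to zero tend to zero. -/
lemma tendsto_zero_of_tendsto_integral {f : ℝ → ℝ → ℝ} {t L : ℝ}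
    (hf : ∀ ω > (0 : ℝ), Continuous (f ω))
    (hL : ∀ ω > (0 : ℝ), ∀ s ∈ Set.Icc t (t + 1), |f ω s - f ω t| ≤ L * (s - t))
    (hint : ∀ r, Tendsto (fun ω => ∫ s in t..r, f ω s) atTop (nhds 0)) :
    Tendsto (fun ω => f ω t) atTop (nhds 0) := by
  rw [Metric.tendsto_nhds]
  intro ε hε
  set M := |L| + 1 with hM
  have hMpos : 0 < M := by positivity
  set δ := min 1 (ε / (4 * M)) with hδ
  have hδpos : 0 < δ := lt_min one_pos (by positivity)
  have hδ1 : δ ≤ 1 := min_le_left _ _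
  have hδM : M * δ ≤ ε / 4 := by
    calc M * δ ≤ M * (ε / (4 * M)) := by gcongr; exact min_le_right _ _
      _ = ε / 4 := by field_simp
  have hI := (Metric.tendsto_nhds.1 (hint (t + δ))) (δ * (ε / 2)) (by positivity)
  filter_upwards [eventually_gt_atTop 0, hI] with ω hω hIω
  rw [dist_zero_right, Real.norm_eq_abs] at hIω ⊢
  have hdiff : ‖∫ s in t..(t + δ), (f ω s - f ω t)‖ ≤ M * δ * |t + δ - t| := by
    refine intervalIntegral.norm_integral_le_of_norm_le_const fun s hs => ?_
    rw [Set.uIoc_of_le (by linarith)] at hs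
    refine (hL ω hω s ⟨hs.1.le, by linarith [hs.2]⟩).trans ?_
    have h1 : L ≤ M := by linarith [le_abs_self L]
    have h2 : 0 ≤ s - t := by linarith [hs.1]
    have h3 : s - t ≤ δ := by linarith [hs.2]
    exact mul_le_mul h1 h3 h2 hMpos.le
  rw [intervalIntegral.integral_sub ((hf ω hω).intervalIntegrable _ _) intervalIntegrable_const,
    intervalIntegral.integral_const, add_sub_cancel_left, smul_eq_mul, abs_of_pos hδpos,
    Real.norm_eq_abs] at hdiff
  have hsum : δ * |f ω t| < δ * ε := by
    calc δ * |f ω t| = |δ * f ω t| := by rw [abs_mul, abs_of_pos hδpos]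
      _ ≤ |∫ s in t..(t + δ), f ω s| + |(∫ s in t..(t + δ), f ω s) - δ * f ω t| := by
        have := abs_sub_abs_le_abs_sub (δ * f ω t) (∫ s in t..(t + δ), f ω s)
        rw [abs_sub_comm] at this
        linarith
      _ < δ * (ε / 2) + M * δ * δ := by linarith
      _ ≤ δ * (ε / 2) + ε / 4 * δ := by gcongr
      _ ≤ δ * ε := by nlinarith
  exact lt_of_mul_lt_mul_left hsum hδpos.le

lemma exists_bound_along_trajectories {B : E3 → E3} {x₀ v₀ : E3} {xω : ℝ → ℝ → E3}
    (hxC : ∀ ω > (0 : ℝ), ContDiff ℝ 2 (xω ω))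
    (hode : ∀ ω > (0 : ℝ), ∀ t : ℝ,
      deriv (deriv (xω ω)) t = ω • cross (deriv (xω ω) t) (B (xω ω t)))
    (hinit : ∀ ω > (0 : ℝ), xω ω 0 = x₀ ∧ deriv (xω ω) 0 = v₀)
    {F : ℝ × E3 × E3 → ℝ} (hF : Continuous F) (a c : ℝ) :
    ∃ C, ∀ ω > (0 : ℝ), ∀ s ∈ Set.uIcc a c, |F (s, xω ω s, deriv (xω ω) s)| ≤ C := by
  obtain ⟨T, hT⟩ := (isCompact_uIcc (a := a) (b := c)).exists_bound_of_continuousOn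
    (f := fun s : ℝ => s) continuousOn_id
  obtain ⟨C, hC⟩ := ((isCompact_uIcc (a := a) (b := c)).prod
    ((isCompact_closedBall x₀ (‖v₀‖ * T)).prod
      (isCompact_closedBall (0 : E3) ‖v₀‖))).exists_bound_of_continuousOn hF.continuousOn
  refine ⟨C, fun ω hω s hs => hC _ ⟨hs, ?_, ?_⟩⟩
  · have h := norm_sub_le_of_lorentz (hxC ω hω) (hode ω hω) s
    rw [(hinit ω hω).1, (hinit ω hω).2] at h
    rw [Metric.mem_closedBall, dist_eq_norm]
    exact h.trans (mul_le_mul_of_nonneg_left (hT s hs) (norm_nonneg _))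
  · have h := norm_deriv_eq_of_lorentz (hxC ω hω) (hode ω hω) s
    rw [(hinit ω hω).2] at h
    rw [mem_closedBall_zero_iff]
    exact h.le

/-- The parallel speeds of the trajectories converge pointwise to the limiting parallel speed. -/
lemma tendsto_parallelSpeed {B b : E3 → E3} {x₀ v₀ : E3} {xω : ℝ → ℝ → E3} {x : ℝ → E3}
    {h : ℝ → ℝ} (hB : ContDiff ℝ 2 B) (hne : ∀ y, B y ≠ 0)
    (hb : b = fun y => ‖B y‖⁻¹ • B y)
    (hxC : ∀ ω > (0 : ℝ), ContDiff ℝ 2 (xω ω))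
    (hode : ∀ ω > (0 : ℝ), ∀ t : ℝ,
      deriv (deriv (xω ω)) t = ω • cross (deriv (xω ω) t) (B (xω ω t)))
    (hinit : ∀ ω > (0 : ℝ), xω ω 0 = x₀ ∧ deriv (xω ω) 0 = v₀)
    (hx : ContDiff ℝ 1 x) (hh : ContDiff ℝ 1 h)
    (hlim : ∀ s, Tendsto (fun ω => xω ω s) atTop (nhds (x s)))
    (hxh : ∀ t, deriv x t = h t • b (x t)) (t : ℝ) :
    Tendsto (fun ω => ⟪deriv (xω ω) t, b (xω ω t)⟫) atTop (nhds (h t)) := by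
  have hbC := contDiff_unitField hB hne hb
  have hbc := hbC.continuous
  have hbd := hbC.differentiable two_ne_zero
  have hDbc := hbC.continuous_fderiv two_ne_zero
  have hh' := hh.continuous_deriv le_rfl
  have hx' := hx.continuous_deriv le_rfl
  have hxc := hx.continuous
  have hyc : ∀ ω > (0 : ℝ), Continuous (xω ω) := fun ω hω => (hxC ω hω).continuous
  have hvc : ∀ ω > (0 : ℝ), Continuous (deriv (xω ω)) := fun ω hω =>
    (hxC ω hω).continuous_deriv one_le_two
  have huc : ∀ ω > (0 : ℝ), Continuous fun s => ⟪deriv (xω ω) s, b (xω ω s)⟫ - h s :=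
    fun ω hω => ((hvc ω hω).inner (hbc.comp (hyc ω hω))).sub hh.continuous
  have hhx : ∀ s, ⟪deriv x s, b (x s)⟫ = h s := fun s => by
    have h1 : ‖b (x s)‖ = 1 := by
      rw [hb, norm_smul, norm_inv, norm_norm, inv_mul_cancel₀ (norm_ne_zero_iff.2 (hne _))]
    rw [hxh, real_inner_smul_left, real_inner_self_eq_norm_sq, h1]
    ring
  suffices H : Tendsto (fun ω => ⟪deriv (xω ω) t, b (xω ω t)⟫ - h t) atTop (nhds 0) by
    simpa using H.add_const (h t)
  obtain ⟨L, hL⟩ := exists_bound_along_trajectories hxC hode hinit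
    (F := fun p => ⟪p.2.2, fderiv ℝ b p.2.1 p.2.2⟫ - deriv h p.1) (by fun_prop) t (t + 1)
  refine tendsto_zero_of_tendsto_integral
    (f := fun ω s => ⟪deriv (xω ω) s, b (xω ω s)⟫ - h s) (L := L) huc ?_ ?_
  · intro ω hω s hs
    have hd : ∀ r, HasDerivAt (fun s => ⟪deriv (xω ω) s, b (xω ω s)⟫ - h s)
        (⟪deriv (xω ω) r, fderiv ℝ b (xω ω r) (deriv (xω ω) r)⟫ - deriv h r) r := fun r =>
      (hasDerivAt_parallelSpeed (hxC ω hω) hb hbd (hode ω hω) r).sub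
        (hh.differentiable one_ne_zero r).hasDerivAt
    have hle : t ≤ t + 1 := by linarith
    have := (convex_Icc t (t + 1)).norm_image_sub_le_of_norm_hasDerivWithin_le (C := L)
      (fun r _ => (hd r).hasDerivWithinAt)
      (fun r hr => hL ω hω r (by rwa [Set.uIcc_of_le hle])) (Set.left_mem_Icc.2 hle) hs
    rwa [Real.norm_eq_abs, Real.norm_eq_abs, abs_of_nonneg (sub_nonneg.2 hs.1)] at this
  · intro r
    set g : ℝ → ℝ → ℝ := fun ω s => ⟪deriv (xω ω) s, b (xω ω s) - b (x s)⟫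
      - ⟪xω ω s - x s, fderiv ℝ b (x s) (deriv x s)⟫ with hg
    have hgc : ∀ ω > (0 : ℝ), Continuous (g ω) := fun ω hω => by
      have := hyc ω hω
      have := hvc ω hω
      fun_prop
    obtain ⟨C, hC⟩ := exists_bound_along_trajectories hxC hode hinit
      (F := fun p => ⟪p.2.2, b p.2.1 - b (x p.1)⟫
        - ⟪p.2.1 - x p.1, fderiv ℝ b (x p.1) (deriv x p.1)⟫) (by fun_prop) t r
    have hdiff : ∀ s, Tendsto (fun ω => xω ω s - x s) atTop (nhds 0) := fun s => by
      simpa using (hlim s).sub_const (x s)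
    have hgl : ∀ s, Tendsto (fun ω => g ω s) atTop (nhds 0) := fun s => by
      have h1 : Tendsto (fun ω => ⟪deriv (xω ω) s, b (xω ω s) - b (x s)⟫) atTop (nhds 0) := by
        have hb0 : Tendsto (fun ω => ‖v₀‖ * ‖b (xω ω s) - b (x s)‖) atTop (nhds 0) := by
          simpa using ((((hbc.tendsto (x s)).comp (hlim s)).sub_const (b (x s))).norm).const_mul
            ‖v₀‖
        refine squeeze_zero_norm' ?_ hb0
        filter_upwards [eventually_gt_atTop 0] with ω hω
        refine (norm_inner_le_norm (𝕜 := ℝ) _ _).trans_eq ?_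
        rw [norm_deriv_eq_of_lorentz (hxC ω hω) (hode ω hω) s, (hinit ω hω).2]
      have h2 := (hdiff s).inner (𝕜 := ℝ)
        (tendsto_const_nhds (x := fderiv ℝ b (x s) (deriv x s)) (f := atTop (α := ℝ)))
      simpa using h1.sub h2
    have hI := tendsto_intervalIntegral_of_bounded hgc hC hgl
    have hD : ∀ s, Tendsto (fun ω => ⟪xω ω s - x s, b (x s)⟫) atTop (nhds 0) := fun s => by
      simpa using (hdiff s).inner (𝕜 := ℝ)
        (tendsto_const_nhds (x := b (x s)) (f := atTop (α := ℝ)))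
    have hsum := ((hD r).sub (hD t)).add hI
    simp only [intervalIntegral.integral_zero, sub_zero, add_zero] at hsum
    refine hsum.congr' ?_
    filter_upwards [eventually_gt_atTop 0] with ω hω
    have hd : ∀ s, HasDerivAt (fun s => ⟪xω ω s - x s, b (x s)⟫)
        (⟪deriv (xω ω) s, b (xω ω s)⟫ - h s - g ω s) s := fun s => by
      have hxs := (hx.differentiable one_ne_zero s).hasDerivAt
      have hys := ((hxC ω hω).differentiable two_ne_zero s).hasDerivAt
      have hbs : HasDerivAt (fun s => b (x s)) (fderiv ℝ b (x s) (deriv x s)) s :=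
        (hbd (x s)).hasFDerivAt.comp_hasDerivAt s hxs
      refine ((hys.sub hxs).inner ℝ hbs).congr_deriv ?_
      simp only [hg, Pi.sub_apply, inner_sub_left, inner_sub_right, ← hhx s]
      ring
    have hFTC := intervalIntegral.integral_eq_sub_of_hasDerivAt (a := t) (b := r)
      (fun s _ => hd s) (((huc ω hω).sub (hgc ω hω)).intervalIntegrable t r)
    rw [intervalIntegral.integral_sub ((huc ω hω).intervalIntegrable t r)
      ((hgc ω hω).intervalIntegrable t r)] at hFTC
    linarith

/-- Averaged equation of motion for the limiting parallel speed. -/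
lemma hasDerivAt_limit_parallelSpeed {B b : E3 → E3} {x₀ v₀ : E3} {xω : ℝ → ℝ → E3}
    {x : ℝ → E3} {h : ℝ → ℝ} (hB : ContDiff ℝ 2 B) (hne : ∀ y, B y ≠ 0)
    (hb : b = fun y => ‖B y‖⁻¹ • B y)
    (hxC : ∀ ω > (0 : ℝ), ContDiff ℝ 2 (xω ω))
    (hode : ∀ ω > (0 : ℝ), ∀ t : ℝ,
      deriv (deriv (xω ω)) t = ω • cross (deriv (xω ω) t) (B (xω ω t)))
    (hinit : ∀ ω > (0 : ℝ), xω ω 0 = x₀ ∧ deriv (xω ω) 0 = v₀)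
    (hx : ContDiff ℝ 1 x) (hh : ContDiff ℝ 1 h)
    (hlim : ∀ s, Tendsto (fun ω => xω ω s) atTop (nhds (x s)))
    (hxh : ∀ t, deriv x t = h t • b (x t)) (t : ℝ) :
    HasDerivAt h (2⁻¹ * ((‖v₀‖ ^ 2 - h t ^ 2) * divergence b (x t))) t := by
  have hbC := contDiff_unitField hB hne hb
  have hbc := hbC.continuous
  have hdivc := continuous_divergence hbC
  have hxc := hx.continuous
  have hhc := hh.continuous
  have hyc : ∀ ω > (0 : ℝ), Continuous (xω ω) := fun ω hω => (hxC ω hω).continuous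
  have hvc : ∀ ω > (0 : ℝ), Continuous (deriv (xω ω)) := fun ω hω =>
    (hxC ω hω).continuous_deriv one_le_two
  have hΨc := (contDiff_gyroCorrector hB hne hbC).continuous
  have hΨ'c := continuous_fderiv_gyroCorrector hB hne hbC
  have hu := tendsto_parallelSpeed hB hne hb hxC hode hinit hx hh hlim hxh
  have hGc : Continuous fun s => 2⁻¹ * ((‖v₀‖ ^ 2 - h s ^ 2) * divergence b (x s)) := by
    fun_prop
  have hint : ∀ r, h r - h 0
      = ∫ s in (0 : ℝ)..r, 2⁻¹ * ((‖v₀‖ ^ 2 - h s ^ 2) * divergence b (x s)) := fun r => by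
    obtain ⟨C, hC⟩ := exists_bound_along_trajectories hxC hode hinit
      (F := fun p => 2⁻¹ * ((‖v₀‖ ^ 2 - ⟪p.2.2, b p.2.1⟫ ^ 2) * divergence b p.2.1))
      (by fun_prop) 0 r
    obtain ⟨C₁, hC₁⟩ := exists_bound_along_trajectories hxC hode hinit
      (F := fun p => gyroCorrector B b p.2) (by fun_prop) 0 r
    obtain ⟨C₂, hC₂⟩ := exists_bound_along_trajectories hxC hode hinit
      (F := fun p => fderiv ℝ (gyroCorrector B b) p.2 (p.2.2, 0))
      (hΨ'c.comp continuous_snd) 0 r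
    have hmain := tendsto_intervalIntegral_of_bounded (a := 0) (c := r)
      (f := fun ω s => 2⁻¹ * ((‖v₀‖ ^ 2 - ⟪deriv (xω ω) s, b (xω ω s)⟫ ^ 2)
        * divergence b (xω ω s)))
      (fun ω hω => by
        have := hyc ω hω
        have := hvc ω hω
        fun_prop) hC
      (fun s => ((tendsto_const_nhds.sub ((hu s).pow 2)).mul
        ((hdivc.tendsto (x s)).comp (hlim s))).const_mul 2⁻¹)
    have hrem : Tendsto (fun ω : ℝ => ω⁻¹ * ((∫ s in (0 : ℝ)..r,
        fderiv ℝ (gyroCorrector B b) (xω ω s, deriv (xω ω) s) (deriv (xω ω) s, 0))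
        - (gyroCorrector B b (xω ω r, deriv (xω ω) r)
          - gyroCorrector B b (xω ω 0, deriv (xω ω) 0)))) atTop (nhds 0) := by
      have hinv : Tendsto (fun ω : ℝ => ω⁻¹ * (C₂ * |r - 0| + (C₁ + C₁))) atTop (nhds 0) := by
        simpa using (tendsto_inv_atTop_zero (𝕜 := ℝ)).mul_const (C₂ * |r - 0| + (C₁ + C₁))
      refine squeeze_zero_norm' ?_ hinv
      filter_upwards [eventually_gt_atTop 0] with ω hω
      rw [norm_mul, norm_inv, Real.norm_of_nonneg hω.le]
      gcongr
      refine (norm_sub_le _ _).trans (add_le_add ?_ ((norm_sub_le _ _).trans (add_le_add ?_ ?_)))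
      · exact intervalIntegral.norm_integral_le_of_norm_le_const fun s hs =>
          hC₂ ω hω s (Set.uIoc_subset_uIcc hs)
      · exact hC₁ ω hω r Set.right_mem_uIcc
      · exact hC₁ ω hω 0 Set.left_mem_uIcc
    have hR := hmain.add hrem
    rw [add_zero] at hR
    refine tendsto_nhds_unique (((hu r).sub (hu 0)).congr' ?_) hR
    filter_upwards [eventually_gt_atTop 0] with ω hω
    have := parallelSpeed_sub_eq hB hne hb hω.ne' (hxC ω hω) (hode ω hω) r
    rw [this, (hinit ω hω).2]
  have hfun : h = fun r => h 0
      + ∫ s in (0 : ℝ)..r, 2⁻¹ * ((‖v₀‖ ^ 2 - h s ^ 2) * divergence b (x s)) := by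
    funext r
    linarith [hint r]
  have hd := (hGc.integral_hasStrictDerivAt 0 t).hasDerivAt.const_add (h 0)
  rwa [← hfun] at hd

/-- Mirror-force equation for the zero order parallel speed:
$\dot h(t) = -\mu_0\, b(x(t))\cdot\nabla|B|(x(t))$. -/
theorem stmt15 (B : E3 → E3) (hB : ContDiff ℝ 2 B) (hne : ∀ y : E3, B y ≠ 0)
    (hdiv : ∀ y : E3, divergence B y = 0) (x₀ v₀ : E3)
    (b : E3 → E3) (hb : b = fun y => ‖B y‖⁻¹ • B y)
    (xω : ℝ → ℝ → E3)
    (hxC : ∀ ω > (0:ℝ), ContDiff ℝ 2 (xω ω))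
    (hode : ∀ ω > (0:ℝ), ∀ t : ℝ,
      deriv (deriv (xω ω)) t = ω • cross (deriv (xω ω) t) (B (xω ω t)))
    (hinit : ∀ ω > (0:ℝ), xω ω 0 = x₀ ∧ deriv (xω ω) 0 = v₀)
    (x : ℝ → E3) (h : ℝ → ℝ) (hx3 : ContDiff ℝ 3 x) (hh2 : ContDiff ℝ 2 h)
    (hconv : ∀ α : ℝ, 0 ≤ α → α < 1 → HolderLocConv xω x α)
    (hxh : ∀ t : ℝ, deriv x t = h t • b (x t))
    (μ₀ : ℝ) (hμ₀ : μ₀ = (‖v₀‖ ^ 2 - h 0 ^ 2) / (2 * ‖B x₀‖)) (t : ℝ) :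
    deriv h t = -μ₀ * ⟪b (x t), gradient (fun y => ‖B y‖) (x t)⟫ := by
  have hbC := contDiff_unitField hB hne hb
  have hlim : ∀ s, Tendsto (fun ω => xω ω s) atTop (nhds (x s)) := fun s => by
    rw [Metric.tendsto_nhds]
    intro ε hε
    obtain ⟨W, hW⟩ := hconv 0 le_rfl one_pos {s} isCompact_singleton (ε / 2) (half_pos hε)
    filter_upwards [eventually_ge_atTop W] with ω hω
    rw [dist_eq_norm]
    linarith [(hW ω hω).1 s rfl]
  have hx0 : x 0 = x₀ := by
    refine tendsto_nhds_unique (hlim 0) (tendsto_const_nhds.congr' ?_)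
    filter_upwards [eventually_gt_atTop 0] with ω hω
    exact (hinit ω hω).1.symm
  have hx1 : ContDiff ℝ 1 x := hx3.of_le (by norm_num)
  have hh' := hasDerivAt_limit_parallelSpeed hB hne hb hxC hode hinit hx1
    (hh2.of_le one_le_two) hlim hxh
  have hN : Differentiable ℝ fun y => ‖B y‖ := fun y =>
    (hB.differentiable two_ne_zero y).norm ℝ (hne y)
  have hn0 : ∀ s, ‖B (x s)‖ ≠ 0 := fun s => norm_ne_zero_iff.2 (hne _)
  have hdivb := divergence_unitField (hB.differentiable two_ne_zero) hne hdiv hb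
    (hbC.differentiable two_ne_zero)
  have hBx : ∀ s, HasDerivAt (fun s => ‖B (x s)‖)
      (h s * fderiv ℝ (fun y => ‖B y‖) (x s) (b (x s))) s := fun s => by
    refine ((hN (x s)).hasFDerivAt.comp_hasDerivAt s
      (hx1.differentiable one_ne_zero s).hasDerivAt).congr_deriv ?_
    rw [hxh, map_smul, smul_eq_mul]
  have hμ : ∀ s, HasDerivAt (fun s => (‖v₀‖ ^ 2 - h s ^ 2) / (2 * ‖B (x s)‖)) 0 s := fun s => by
    refine ((((hh' s).pow 2).const_sub (‖v₀‖ ^ 2)).div ((hBx s).const_mul 2)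
      (mul_ne_zero two_ne_zero (hn0 s))).congr_deriv ?_
    rw [hdivb]
    have := hn0 s
    field_simp
    simp
  have hμt : (‖v₀‖ ^ 2 - h t ^ 2) / (2 * ‖B (x t)‖) = μ₀ := by
    rw [hμ₀, ← hx0]
    exact is_const_of_deriv_eq_zero (fun s => (hμ s).differentiableAt)
      (fun s => (hμ s).deriv) t 0
  rw [(hh' t).deriv, hdivb, real_inner_comm, inner_gradient_left, ← hμt]
  have := hn0 t
  field_simp
end
end
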